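/- Let α: [0,∞) → [0,+∞] be a left-continuous, non-decreasing, convex function with α(0) = 0. Suppose μ satisfies the inequality α(W₁(ν,μ)) ≤ I(ν|μ) for all probability measures ν on ℝⁿ. Then μ satisfies α̃(W₁(ν,μ)) ≤ H(ν|μ) for all probability measures ν, where α̃(r) = 2∫₀^r √α(s) ds. In particular, for every Lipschitz function g with Lipschitz constant at most 1 and every r > 0, μ(g > μ(g) + r) ≤ e^{−α̃(r)}. -/

import Mathlib

open MeasureTheory ENNReal Classical

/-- A coupling of `ν` and `μ`. -/
def IsCoupling {n : ℕ}
    (π : Measure (EuclideanSpace ℝ (Fin n) × EuclideanSpace ℝ (Fin n)))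
    (ν μ : Measure (EuclideanSpace ℝ (Fin n))) : Prop :=
  π.map Prod.fst = ν ∧ π.map Prod.snd = μ

/-- The `L^p`-Wasserstein distance for the Euclidean distance. -/
noncomputable def wassersteinDist {n : ℕ} (p : ℝ)
    (ν μ : Measure (EuclideanSpace ℝ (Fin n))) : ℝ≥0∞ :=
  (⨅ (π : Measure (EuclideanSpace ℝ (Fin n) × EuclideanSpace ℝ (Fin n)))
      (_ : IsCoupling π ν μ), ∫⁻ q, edist q.1 q.2 ^ p ∂π) ^ (1 / p)

/-- The relative entropy (Kullback information) `H(ν|μ)`. -/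
noncomputable def relEntropy {n : ℕ}
    (ν μ : Measure (EuclideanSpace ℝ (Fin n))) : ℝ≥0∞ :=
  if ν ≪ μ ∧ Integrable (llr ν μ) ν then ENNReal.ofReal (∫ x, llr ν μ x ∂ν) else ⊤

/-- The Fisher information `I(ν|μ) = ∫ |∇√f|² dμ` for `ν = fμ` with `√f ∈ H¹(μ)`,
and `+∞` otherwise. -/
noncomputable def fisherInfo {n : ℕ}
    (ν μ : Measure (EuclideanSpace ℝ (Fin n))) : ℝ≥0∞ :=
  ⨅ (f : EuclideanSpace ℝ (Fin n) → ℝ) (_ : ∀ x, 0 ≤ f x)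
    (_ : ν = μ.withDensity fun x => ENNReal.ofReal (f x))
    (_ : Differentiable ℝ fun x => Real.sqrt (f x)),
    ∫⁻ x, (‖gradient (fun y => Real.sqrt (f y)) x‖₊ : ℝ≥0∞) ^ 2 ∂μ

/-- Young-type inequality: if `F 0 = 0` and `F'` is bounded by the generalized inverse of the
monotone function `u`, then `F (u r) ≤ r u(r) - ∫₀ʳ u`. -/
theorem add_integral_le_mul_of_deriv_le_inverse {F u : ℝ → ℝ} (hF : Differentiable ℝ F)
    (hF0 : F 0 = 0) (hu0 : u 0 = 0) (hu : MonotoneOn u (Set.Ici 0))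
    (h : ∀ t, 0 ≤ t → ∀ s, 0 ≤ s → s ≤ deriv F t → u s ≤ t) {r : ℝ} (hr : 0 ≤ r) :
    F (u r) + ∫ s in (0 : ℝ)..r, u s ≤ r * u r := by
  have hpos : ∀ s, 0 ≤ s → 0 ≤ u s := fun s hs =>
    hu0 ▸ hu Set.self_mem_Ici hs hs
  have hint : ∀ a b, 0 ≤ a → 0 ≤ b → IntervalIntegrable u volume a b := fun a b ha hb =>
    (hu.mono fun x hx => le_trans (le_min ha hb) hx.1).intervalIntegrable
  have step : ∀ a b, 0 ≤ a → a ≤ b →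
      F (u b) - F (u a) ≤ b * (u b - u a) ∧ ∫ s in a..b, u s ≤ (b - a) * u b := by
    intro a b ha hab
    have hb := ha.trans hab
    refine ⟨?_, ?_⟩
    · refine (convex_Icc (u a) (u b)).image_sub_le_mul_sub_of_deriv_le hF.continuous.continuousOn
        hF.differentiableOn (fun t ht => ?_) _ (Set.left_mem_Icc.2 (hu ha hb hab)) _
        (Set.right_mem_Icc.2 (hu ha hb hab)) (hu ha hb hab)
      rw [interior_Icc] at ht
      by_contra! hlt
      exact absurd (h t ((hpos a ha).trans ht.1.le) b hb hlt.le) (not_le.2 ht.2)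
    · calc ∫ s in a..b, u s ≤ ∫ _ in a..b, u b :=
            intervalIntegral.integral_mono_on hab (hint a b ha hb) intervalIntegrable_const
              fun x hx => hu (ha.trans hx.1) hb hx.2
        _ = (b - a) * u b := by simp
  have key : ∀ N : ℕ, 0 < N → F (u r) + ∫ s in (0 : ℝ)..r, u s ≤ r * u r + r * u r / N := by
    intro N hN
    have hN' : (0 : ℝ) < N := by exact_mod_cast hN
    set d := r / N with hd
    have hd0 : 0 ≤ d := by positivity
    have ind : ∀ k : ℕ, F (u (k * d)) + ∫ s in (0 : ℝ)..(k * d), u s ≤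
        k * d * u (k * d) + d * u (k * d) := by
      intro k
      induction k with
      | zero => simp [hu0, hF0]
      | succ k ih =>
        have hk : 0 ≤ k * d := by positivity
        have hk' : (k * d : ℝ) ≤ ((k + 1 : ℕ) : ℝ) * d := by
          push_cast; nlinarith
        obtain ⟨h1, h2⟩ := step _ _ hk hk'
        rw [← intervalIntegral.integral_add_adjacent_intervals (hint 0 (k * d) le_rfl hk)
          (hint (k * d) _ hk (hk.trans hk'))]
        push_cast at *
        nlinarith
    have := ind N
    rw [show (N : ℝ) * d = r by rw [hd]; field_simp] at this
    calc _ ≤ _ := this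
      _ = _ := by rw [hd]; ring
  have lim : Filter.Tendsto (fun N : ℕ => r * u r + r * u r / N) Filter.atTop
      (nhds (r * u r + 0)) := tendsto_const_nhds.add (tendsto_const_div_atTop_nhds_zero_nat _)
  rw [add_zero] at lim
  exact ge_of_tendsto lim (Filter.eventually_atTop.2 ⟨1, fun N hN => key N hN⟩)

/-- A `1`-Lipschitz function is uniformly approximated by differentiable `1`-Lipschitz
functions. -/
theorem LipschitzWith.exists_differentiable_dist_le {n : ℕ} {g : EuclideanSpace ℝ (Fin n) → ℝ}
    (hg : LipschitzWith 1 g) {ε : ℝ} (hε : 0 < ε) :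
    ∃ h : EuclideanSpace ℝ (Fin n) → ℝ, Differentiable ℝ h ∧ LipschitzWith 1 h ∧
      ∀ x, |h x - g x| ≤ ε := by
  set φ : ContDiffBump (0 : EuclideanSpace ℝ (Fin n)) := ⟨ε / 2, ε, half_pos hε, half_lt_self hε⟩
  have hint : ∀ x, Integrable (fun t => φ.normed volume t * g (x - t)) volume := fun x =>
    (Continuous.mul φ.continuous_normed (hg.continuous.comp (by fun_prop))).integrable_of_hasCompactSupport
      φ.hasCompactSupport_normed.mul_right
  refine ⟨convolution (φ.normed volume) g (ContinuousLinearMap.lsmul ℝ ℝ) volume, ?_, ?_, ?_⟩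
  · exact (φ.hasCompactSupport_normed.contDiff_convolution_left (n := 1) _ φ.contDiff_normed
      hg.continuous.locallyIntegrable).differentiable (by norm_num)
  · refine LipschitzWith.of_le_add fun x y => ?_
    simp only [convolution, ContinuousLinearMap.lsmul_apply, smul_eq_mul]
    calc ∫ t, φ.normed volume t * g (x - t)
        ≤ ∫ t, (φ.normed volume t * g (y - t) + φ.normed volume t * dist x y) := by
          refine integral_mono (hint x) ((hint y).add (φ.integrable_normed.mul_const _)) fun t => ?_
          have h1 := hg.le_add_mul (x - t) (y - t)
          have h2 := φ.nonneg_normed (μ := volume) t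
          simp only [NNReal.coe_one, one_mul, dist_sub_right] at h1
          simp only [← mul_add]
          exact mul_le_mul_of_nonneg_left h1 h2
      _ = _ := by
          rw [integral_add (hint y) (φ.integrable_normed.mul_const _), integral_mul_const,
            φ.integral_normed, one_mul]
  · intro x
    rw [← Real.dist_eq]
    refine φ.dist_normed_convolution_le hg.continuous.aestronglyMeasurable fun y hy => ?_
    exact (hg.dist_le_mul y x).trans (by simpa using (Metric.mem_ball.1 hy).le)

/-- The Fisher information of an exponential tilt by a potential with gradient bounded by `K` is at
most `K² / 4`. -/
theorem fisherInfo_tilted_le {n : ℕ} {μ : Measure (EuclideanSpace ℝ (Fin n))}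
    [IsProbabilityMeasure μ] {φ : EuclideanSpace ℝ (Fin n) → ℝ} (hφ : Differentiable ℝ φ)
    {K : ℝ} (hK : ∀ x, ‖fderiv ℝ φ x‖ ≤ K) (hint : Integrable (fun x => Real.exp (φ x)) μ) :
    fisherInfo (μ.tilted φ) μ ≤ ENNReal.ofReal (K ^ 2 / 4) := by
  have hZ : 0 < ∫ x, Real.exp (φ x) ∂μ := integral_exp_pos hint
  set Z := ∫ x, Real.exp (φ x) ∂μ with hZdef
  have hsqrt : (fun x => Real.sqrt (Real.exp (φ x) / Z)) =
      fun x => Real.exp (φ x / 2) / Real.sqrt Z := by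
    funext x
    rw [Real.sqrt_div (Real.exp_pos _).le, Real.exp_half]
  have hder : ∀ x, HasFDerivAt (fun x => Real.exp (φ x / 2) / Real.sqrt Z)
      ((Real.exp (φ x / 2) / (2 * Real.sqrt Z)) • fderiv ℝ φ x) x := by
    intro x
    have h1 := ((hφ x).hasFDerivAt.mul_const (2 : ℝ)⁻¹).exp.mul_const (Real.sqrt Z)⁻¹
    convert! h1 using 1
    rw [smul_smul, smul_smul, ← div_eq_mul_inv]
    congr 1
    field_simp
  refine iInf_le_of_le (fun x => Real.exp (φ x) / Z) (iInf_le_of_le (fun x => by positivity)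
    (iInf_le_of_le rfl (iInf_le_of_le ?_ ?_)))
  · rw [hsqrt]
    exact fun x => (hder x).differentiableAt
  · rw [hsqrt]
    have hprob := isProbabilityMeasure_tilted hint
    calc ∫⁻ x, (‖gradient (fun y => Real.exp (φ y / 2) / Real.sqrt Z) x‖₊ : ℝ≥0∞) ^ 2 ∂μ
        ≤ ∫⁻ x, ENNReal.ofReal (Real.exp (φ x) / Z) * ENNReal.ofReal (K ^ 2 / 4) ∂μ := by
          refine lintegral_mono fun x => ?_
          rw [← ENNReal.ofReal_mul (by positivity), ← enorm_eq_nnnorm, ← ofReal_norm,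
            ← ENNReal.ofReal_pow (norm_nonneg _)]
          refine ENNReal.ofReal_le_ofReal ?_
          rw [gradient, LinearIsometryEquiv.norm_map, (hder x).fderiv, norm_smul, mul_pow,
            Real.norm_eq_abs, sq_abs, div_pow, mul_pow, Real.sq_sqrt hZ.le, ← Real.exp_nat_mul]
          have : ‖fderiv ℝ φ x‖ ^ 2 ≤ K ^ 2 := pow_le_pow_left₀ (norm_nonneg _) (hK x) 2
          calc _ ≤ Real.exp ((2 : ℕ) * (φ x / 2)) / (2 ^ 2 * Z) * K ^ 2 := by gcongr
            _ = _ := by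
              rw [show ((2 : ℕ) : ℝ) * (φ x / 2) = φ x by push_cast; ring]
              ring
      _ = ENNReal.ofReal (K ^ 2 / 4) := by
          rw [lintegral_mul_const' _ _ ENNReal.ofReal_ne_top]
          have h1 : ∫⁻ x, ENNReal.ofReal (Real.exp (φ x) / Z) ∂μ = μ.tilted φ Set.univ := by
            rw [Measure.tilted, withDensity_apply _ MeasurableSet.univ, setLIntegral_univ]
          rw [h1, measure_univ, one_mul]

theorem wassersteinDist_one {n : ℕ} (ν μ : Measure (EuclideanSpace ℝ (Fin n))) :
    wassersteinDist 1 ν μ =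
      ⨅ (π : Measure (EuclideanSpace ℝ (Fin n) × EuclideanSpace ℝ (Fin n)))
        (_ : IsCoupling π ν μ), ∫⁻ q, edist q.1 q.2 ∂π := by
  simp [wassersteinDist]

/-- The easy half of Kantorovich–Rubinstein duality. -/
theorem ofReal_integral_sub_le_wassersteinDist {n : ℕ}
    {ν μ : Measure (EuclideanSpace ℝ (Fin n))} {g : EuclideanSpace ℝ (Fin n) → ℝ}
    (hg : LipschitzWith 1 g) (hν : Integrable g ν) (hμ : Integrable g μ) :
    ENNReal.ofReal (∫ x, g x ∂ν - ∫ x, g x ∂μ) ≤ wassersteinDist 1 ν μ := by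
  rw [wassersteinDist_one]
  refine le_iInf₂ fun π hπ => ?_
  obtain ⟨rfl, rfl⟩ := hπ
  have h1 : Integrable (fun q => g (Prod.fst q)) π := hν.comp_measurable measurable_fst
  have h2 : Integrable (fun q => g (Prod.snd q)) π := hμ.comp_measurable measurable_snd
  rw [integral_map measurable_fst.aemeasurable hg.continuous.aestronglyMeasurable,
    integral_map measurable_snd.aemeasurable hg.continuous.aestronglyMeasurable,
    ← integral_sub h1 h2]
  refine (ENNReal.ofReal_le_ofReal (le_abs_self _)).trans ?_
  rw [← Real.norm_eq_abs, ofReal_norm]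
  refine (enorm_integral_le_lintegral_enorm _).trans (lintegral_mono fun q => ?_)
  simpa [edist_eq_enorm_sub] using hg q.1 q.2

/-- The Donsker–Varadhan (Gibbs) variational inequality. -/
theorem integral_sub_log_integral_exp_le_integral_llr {Ω : Type*} [MeasurableSpace Ω]
    {ν μ : Measure Ω} [IsProbabilityMeasure ν] [IsProbabilityMeasure μ] (hνμ : ν ≪ μ)
    (hllr : Integrable (llr ν μ) ν) {f : Ω → ℝ} (hfν : Integrable f ν)
    (hfμ : Integrable (fun x => Real.exp (f x)) μ) :
    ∫ x, f x ∂ν - Real.log (∫ x, Real.exp (f x) ∂μ) ≤ ∫ x, llr ν μ x ∂ν := by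
  have hprob := isProbabilityMeasure_tilted hfμ
  have h1 := integral_llr_tilted_right hνμ hfν hfμ hllr
  have h2 := InformationTheory.integral_llr_add_sub_measure_univ_nonneg
    (hνμ.trans (absolutelyContinuous_tilted hfμ)) (integrable_llr_tilted_right hνμ hfν hllr hfμ)
  simp only [probReal_univ] at h2
  linarith

/-- Kantorovich duality for the finite transport problem. -/
theorem exists_transport_plan_of_dual_le {ι : Type*} [Fintype ι] (d : ι → ι → ℝ) {a b : ι → ℝ}
    (ha : a ∈ stdSimplex ℝ ι) (hb : b ∈ stdSimplex ℝ ι) {r : ℝ}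
    (H : ∀ φ ψ : ι → ℝ, (∀ i j, φ i + ψ j ≤ d i j) → ∑ i, φ i * a i + ∑ j, ψ j * b j ≤ r) :
    ∃ w : ι × ι → ℝ, (∀ q, 0 ≤ w q) ∧ (∀ i, ∑ j, w (i, j) = a i) ∧ (∀ j, ∑ i, w (i, j) = b j) ∧
      ∑ q, w q * d q.1 q.2 ≤ r := by
  let L : (ι × ι → ℝ) →ₗ[ℝ] ((ι → ℝ) × (ι → ℝ) × ℝ) :=
    { toFun := fun w => (fun i => ∑ j, w (i, j), fun j => ∑ i, w (i, j), ∑ q, w q * d q.1 q.2)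
      map_add' := fun x y => by
        ext <;> simp [Finset.sum_add_distrib, add_mul]
      map_smul' := fun c x => by
        ext <;> simp [Finset.mul_sum, mul_assoc] }
  by_contra hcon
  have hdisj : Disjoint (L '' stdSimplex ℝ (ι × ι)) ({a} ×ˢ {b} ×ˢ Set.Iic r) := by
    rw [Set.disjoint_left]
    rintro _ ⟨w, hw, rfl⟩ ⟨h1, h2, h3⟩
    exact hcon ⟨w, hw.1, fun i => congrFun h1 i, fun j => congrFun h2 j, h3⟩
  obtain ⟨f, u, v, hfu, huv, hfv⟩ := geometric_hahn_banach_compact_closed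
    ((convex_stdSimplex ℝ (ι × ι)).linear_image L)
    ((isCompact_stdSimplex ℝ (ι × ι)).image L.continuous_of_finiteDimensional)
    ((convex_singleton a).prod ((convex_singleton b).prod (convex_Iic r)))
    (isClosed_singleton.prod (isClosed_singleton.prod isClosed_Iic)) hdisj
  set p : ι → ℝ := fun i => f (Pi.single i 1, 0, 0) with hp
  set q : ι → ℝ := fun j => f (0, Pi.single j 1, 0) with hq
  set t : ℝ := f (0, 0, 1) with ht
  have hf : ∀ x y s, f (x, y, s) = ∑ i, p i * x i + ∑ j, q j * y j + t * s := by
    intro x y s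
    have h1 : ((x, y, s) : (ι → ℝ) × (ι → ℝ) × ℝ) =
        (∑ i, x i • (Pi.single i 1, 0, 0)) + (∑ j, y j • (0, Pi.single j 1, 0)) +
          s • ((0, 0, 1) : (ι → ℝ) × (ι → ℝ) × ℝ) := by
      ext k <;> simp [Prod.fst_sum, Prod.snd_sum, Finset.sum_apply, Pi.single_apply]
    rw [h1, map_add, map_add, map_sum, map_sum, map_smul, smul_eq_mul, mul_comm t]
    simp only [map_smul, smul_eq_mul, hp, hq, ht, mul_comm]
  have hvert : ∀ i j, p i + q j + t * d i j < u := by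
    intro i j
    have h1 := hfu _ ⟨Pi.single (i, j) 1, single_mem_stdSimplex ℝ (i, j), rfl⟩
    have h2 : L (Pi.single (i, j) 1) = (Pi.single i 1, Pi.single j 1, d i j) := by
      ext k
      · simp [L, Pi.single_apply, Prod.ext_iff, ite_and, eq_comm]
      · simp [L, Pi.single_apply, Prod.ext_iff, ite_and, eq_comm]
      · simp [L, Pi.single_apply]
    rw [h2, hf] at h1
    simpa [Pi.single_apply] using h1
  set A := ∑ i, p i * a i + ∑ j, q j * b j with hA
  have htarget : ∀ s ≤ r, v < A + t * s := fun s hs => by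
    have := hfv (a, b, s) ⟨rfl, rfl, hs⟩
    rwa [hf] at this
  have hsum : ∀ (φ ψ : ι → ℝ), ∑ i, φ i * a i + ∑ j, ψ j * b j =
      ∑ i, ∑ j, (φ i + ψ j) * (a i * b j) := by
    intro φ ψ
    have h1 : ∀ i, ∑ j, (φ i + ψ j) * (a i * b j) = φ i * a i + a i * ∑ j, ψ j * b j := by
      intro i
      calc _ = φ i * a i * ∑ j, b j + a i * ∑ j, ψ j * b j := by
            rw [Finset.mul_sum, Finset.mul_sum, ← Finset.sum_add_distrib]
            exact Finset.sum_congr rfl fun j _ => by ring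
        _ = _ := by rw [hb.2, mul_one]
    simp only [h1, Finset.sum_add_distrib, ← Finset.sum_mul, ha.2, one_mul]
  have ht0 : t ≤ 0 := by
    by_contra! htpos
    have h1 := htarget (min r ((v - A) / t)) (min_le_left _ _)
    have h2 : t * min r ((v - A) / t) ≤ v - A := by
      calc _ ≤ t * ((v - A) / t) := by gcongr; exact min_le_right _ _
        _ = _ := by field_simp
    linarith
  rcases ht0.eq_or_lt with h0 | hneg
  · have h1 : A ≤ u := by
      rw [hA, hsum]
      calc _ ≤ ∑ i, ∑ j, u * (a i * b j) := by
            gcongr with i _ j _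
            · exact mul_nonneg (ha.1 i) (hb.1 j)
            · have := hvert i j
              rw [h0] at this
              linarith
        _ = u := by
            simp only [← Finset.mul_sum, hb.2, ha.2, mul_one]
    have := htarget r le_rfl
    rw [h0] at this
    linarith
  · have hs : 0 < -t := by linarith
    have h1 := H (fun i => (p i - u) / -t) (fun j => q j / -t) fun i j => by
      rw [← add_div, div_le_iff₀ hs]
      linarith [hvert i j]
    have h2 : ∑ i, (p i - u) / -t * a i + ∑ j, q j / -t * b j = (A - u) / -t := by
      rw [hA]
      have e1 : ∀ i, (p i - u) / -t * a i = (p i * a i - u * a i) / -t := fun i => by ring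
      have e2 : ∀ j, q j / -t * b j = (q j * b j) / -t := fun i => by ring
      simp only [e1, e2, ← Finset.sum_div, Finset.sum_sub_distrib, ← Finset.mul_sum, ha.2]
      ring
    rw [h2, div_le_iff₀ hs] at h1
    linarith [htarget r le_rfl]

/-- A transport plan between the images of `ν` and `μ` under a finite-valued map `T` lifts to a
coupling of `ν` and `μ`. -/
theorem wassersteinDist_one_le_of_transport_plan {n : ℕ}
    {ν μ : Measure (EuclideanSpace ℝ (Fin n))} [IsProbabilityMeasure ν] [IsProbabilityMeasure μ]
    {ι : Type*} [Fintype ι] [MeasurableSpace ι] [MeasurableSingletonClass ι]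
    {T : EuclideanSpace ℝ (Fin n) → ι} (hT : Measurable T) (p : ι → EuclideanSpace ℝ (Fin n))
    {w : ι × ι → ℝ≥0∞} (hw₁ : ∀ i, ∑ j, w (i, j) = ν (T ⁻¹' {i}))
    (hw₂ : ∀ j, ∑ i, w (i, j) = μ (T ⁻¹' {j})) :
    wassersteinDist 1 ν μ ≤ ∫⁻ x, edist x (p (T x)) ∂ν + ∑ q, w q * edist (p q.1) (p q.2) +
      ∫⁻ x, edist x (p (T x)) ∂μ := by
  set a : ι → ℝ≥0∞ := fun i => ν (T ⁻¹' {i}) with ha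
  set b : ι → ℝ≥0∞ := fun j => μ (T ⁻¹' {j}) with hb
  have hpush : ∀ (ρ : Measure (EuclideanSpace ℝ (Fin n))) (h : ι → ℝ≥0∞),
      ∫⁻ x, h (T x) ∂ρ = ∑ i, h i * ρ (T ⁻¹' {i}) := by
    intro ρ h
    rw [← lintegral_map (measurable_of_finite h) hT, lintegral_fintype]
    exact Finset.sum_congr rfl fun i _ => by rw [Measure.map_apply hT (measurableSet_singleton i)]
  set k : ι → ι → ℝ≥0∞ := fun i j => w (i, j) / (a i * b j) with hk
  have hcancel : ∀ i j, k i j * (a i * b j) = w (i, j) := by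
    intro i j
    have hwa : w (i, j) ≤ a i := (Finset.single_le_sum (f := fun j => w (i, j))
      (fun _ _ => zero_le) (Finset.mem_univ j)).trans_eq (hw₁ i)
    have hwb : w (i, j) ≤ b j := (Finset.single_le_sum (f := fun i => w (i, j))
      (fun _ _ => zero_le) (Finset.mem_univ i)).trans_eq (hw₂ j)
    by_cases h0 : a i * b j = 0
    · have : w (i, j) = 0 := by
        rcases mul_eq_zero.1 h0 with h | h
        · exact le_zero_iff.1 (h ▸ hwa)
        · exact le_zero_iff.1 (h ▸ hwb)
      rw [h0, mul_zero, this]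
    · exact ENNReal.div_mul_cancel h0 (ENNReal.mul_ne_top (measure_ne_top _ _) (measure_ne_top _ _))
  have hkm : Measurable fun q : EuclideanSpace ℝ (Fin n) × EuclideanSpace ℝ (Fin n) =>
      k (T q.1) (T q.2) :=
    (measurable_of_finite fun q : ι × ι => k q.1 q.2).comp
      ((hT.comp measurable_fst).prodMk (hT.comp measurable_snd))
  have hnull : ∀ (ρ : Measure (EuclideanSpace ℝ (Fin n))), ∀ᵐ x ∂ρ, ρ (T ⁻¹' {T x}) ≠ 0 := by
    intro ρ
    rw [ae_iff]
    have : {x | ¬ ρ (T ⁻¹' {T x}) ≠ 0} ⊆ ⋃ i ∈ {i | ρ (T ⁻¹' {i}) = 0}, T ⁻¹' {i} := by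
      intro x hx
      simp only [ne_eq, not_not, Set.mem_ofPred_eq] at hx
      exact Set.mem_biUnion (x := T x) hx rfl
    exact measure_mono_null this
      ((measure_biUnion_null_iff (Set.toFinite _).countable).2 fun i hi => hi)
  have hone₁ : ∀ᵐ x ∂ν, ∫⁻ y, k (T x) (T y) ∂μ = 1 := by
    filter_upwards [hnull ν] with x hx
    have h1 : (∫⁻ y, k (T x) (T y) ∂μ) * a (T x) = 1 * a (T x) := by
      rw [hpush μ (k (T x)), Finset.sum_mul, one_mul]
      refine Eq.trans ?_ (hw₁ (T x))
      exact Finset.sum_congr rfl fun j _ => by rw [← hcancel]; ring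
    exact (ENNReal.mul_left_inj hx (measure_ne_top _ _)).1 h1
  have hone₂ : ∀ᵐ y ∂μ, ∫⁻ x, k (T x) (T y) ∂ν = 1 := by
    filter_upwards [hnull μ] with y hy
    have h1 : (∫⁻ x, k (T x) (T y) ∂ν) * b (T y) = 1 * b (T y) := by
      rw [hpush ν (fun i => k i (T y)), Finset.sum_mul, one_mul]
      refine Eq.trans ?_ (hw₂ (T y))
      exact Finset.sum_congr rfl fun j _ => by rw [← hcancel]; ring
    exact (ENNReal.mul_left_inj hy (measure_ne_top _ _)).1 h1
  set π := (ν.prod μ).withDensity fun q => k (T q.1) (T q.2) with hπ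
  have hfst : ∀ h : EuclideanSpace ℝ (Fin n) → ℝ≥0∞, Measurable h →
      ∫⁻ q, h q.1 ∂π = ∫⁻ x, h x ∂ν := by
    intro h hh
    have hh' : Measurable fun q : EuclideanSpace ℝ (Fin n) × EuclideanSpace ℝ (Fin n) => h q.1 :=
      hh.comp measurable_fst
    rw [hπ, lintegral_withDensity_eq_lintegral_mul _ hkm hh',
      lintegral_prod _ (hkm.mul hh').aemeasurable]
    refine lintegral_congr_ae ?_
    filter_upwards [hone₁] with x hx
    simp only [Pi.mul_apply]
    exact (lintegral_mul_const (h x) (hkm.comp measurable_prodMk_left)).trans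
      ((congrArg (· * h x) hx).trans (one_mul _))
  have hsnd : ∀ h : EuclideanSpace ℝ (Fin n) → ℝ≥0∞, Measurable h →
      ∫⁻ q, h q.2 ∂π = ∫⁻ x, h x ∂μ := by
    intro h hh
    have hh' : Measurable fun q : EuclideanSpace ℝ (Fin n) × EuclideanSpace ℝ (Fin n) => h q.2 :=
      hh.comp measurable_snd
    rw [hπ, lintegral_withDensity_eq_lintegral_mul _ hkm hh',
      lintegral_prod_symm _ (hkm.mul hh').aemeasurable]
    refine lintegral_congr_ae ?_
    filter_upwards [hone₂] with x hx
    simp only [Pi.mul_apply]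
    exact (lintegral_mul_const (h x) (hkm.comp measurable_prodMk_right)).trans
      ((congrArg (· * h x) hx).trans (one_mul _))
  have hmid : ∀ c : ι → ι → ℝ≥0∞,
      ∫⁻ q, c (T q.1) (T q.2) ∂π = ∑ q : ι × ι, w q * c q.1 q.2 := by
    intro c
    have hdm : Measurable fun q : EuclideanSpace ℝ (Fin n) × EuclideanSpace ℝ (Fin n) =>
        c (T q.1) (T q.2) :=
      (measurable_of_finite fun q : ι × ι => c q.1 q.2).comp
        ((hT.comp measurable_fst).prodMk (hT.comp measurable_snd))
    rw [hπ, lintegral_withDensity_eq_lintegral_mul _ hkm hdm,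
      lintegral_prod _ (hkm.mul hdm).aemeasurable, Fintype.sum_prod_type]
    simp only [Pi.mul_apply]
    refine (hpush ν fun i => ∫⁻ y, k i (T y) * c i (T y) ∂μ).trans ?_
    refine Finset.sum_congr rfl fun i _ => ?_
    rw [hpush μ fun j => k i j * c i j, Finset.sum_mul]
    refine Finset.sum_congr rfl fun j _ => ?_
    rw [← hcancel]
    simp only [ha, hb]
    ring
  have hpT : Measurable fun x => edist x (p (T x)) :=
    measurable_id.edist ((measurable_of_finite p).comp hT)
  have hpT₁ : Measurable fun q : EuclideanSpace ℝ (Fin n) × EuclideanSpace ℝ (Fin n) =>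
      edist q.1 (p (T q.1)) := hpT.comp measurable_fst
  have hpT₂ : Measurable fun q : EuclideanSpace ℝ (Fin n) × EuclideanSpace ℝ (Fin n) =>
      edist q.2 (p (T q.2)) := hpT.comp measurable_snd
  rw [wassersteinDist_one]
  refine iInf₂_le_of_le π ⟨?_, ?_⟩ ?_
  · ext s hs
    rw [Measure.map_apply measurable_fst hs, ← lintegral_indicator_one (measurable_fst hs),
      ← lintegral_indicator_one hs, ← hfst _ (measurable_one.indicator hs)]
    rfl
  · ext s hs
    rw [Measure.map_apply measurable_snd hs, ← lintegral_indicator_one (measurable_snd hs),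
      ← lintegral_indicator_one hs, ← hsnd _ (measurable_one.indicator hs)]
    rfl
  · rw [← hfst _ hpT, ← hsnd _ hpT, ← hmid fun i j => edist (p i) (p j),
      ← lintegral_add_left hpT₁, ← lintegral_add_right _ hpT₂]
    refine lintegral_mono fun q => ?_
    refine (edist_triangle4 q.1 (p (T q.1)) (p (T q.2)) q.2).trans ?_
    rw [edist_comm q.2]

/-- Finite dual potentials are dominated by a single bounded `1`-Lipschitz function. -/
theorem exists_lipschitzWith_one_of_add_le_dist {X ι : Type*} [PseudoMetricSpace X] [Fintype ι]
    [Nonempty ι] {p : ι → X} {φ ψ : ι → ℝ} (h : ∀ i j, φ i + ψ j ≤ dist (p i) (p j)) :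
    ∃ g : X → ℝ, LipschitzWith 1 g ∧ (∃ M, ∀ x, |g x| ≤ M) ∧ (∀ i, φ i ≤ g (p i)) ∧
      ∀ j, g (p j) ≤ -ψ j := by
  set f : X → ℝ := fun x => Finset.univ.inf' Finset.univ_nonempty fun j => dist x (p j) - ψ j with hf
  have hfL : LipschitzWith 1 f := by
    refine LipschitzWith.of_le_add fun x y => ?_
    obtain ⟨j, -, hj⟩ := Finset.exists_mem_eq_inf' Finset.univ_nonempty fun j => dist y (p j) - ψ j
    simp only [hf]
    rw [hj]
    refine (Finset.inf'_le _ (Finset.mem_univ j)).trans ?_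
    linarith [dist_triangle x y (p j)]
  set M : ℝ := ∑ i, (|φ i| + |ψ i|) with hM
  have hMi : ∀ i, |φ i| + |ψ i| ≤ M := fun i =>
    Finset.single_le_sum (f := fun i => |φ i| + |ψ i|) (fun _ _ => by positivity)
      (Finset.mem_univ i)
  have hM0 : 0 ≤ M := Finset.sum_nonneg fun _ _ => by positivity
  refine ⟨fun x => max (-M) (min M (f x)), (hfL.const_min M).const_max (-M), ⟨M, fun x => ?_⟩,
    fun i => ?_, fun j => ?_⟩
  · exact abs_le.2 ⟨le_max_left _ _, max_le (by linarith) (min_le_left _ _)⟩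
  · refine le_max_of_le_right (le_min ?_ ?_)
    · linarith [hMi i, le_abs_self (φ i), abs_nonneg (ψ i)]
    · exact Finset.le_inf' _ _ fun j _ => by linarith [h i j]
  · refine max_le ?_ (min_le_of_right_le ((Finset.inf'_le _ (Finset.mem_univ j)).trans ?_))
    · linarith [hMi j, le_abs_self (ψ j), abs_nonneg (φ j)]
    · simp

/-- A measure whose integrals of bounded `1`-Lipschitz functions are controlled by those of a
measure with finite first moment has finite first moment. -/
theorem integrable_id_of_forall_lipschitz {n : ℕ} {ν μ : Measure (EuclideanSpace ℝ (Fin n))}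
    [IsProbabilityMeasure ν] [IsProbabilityMeasure μ]
    (hμ : Integrable (fun x : EuclideanSpace ℝ (Fin n) => x) μ) {r : ℝ}
    (H : ∀ g : EuclideanSpace ℝ (Fin n) → ℝ, LipschitzWith 1 g → (∃ M, ∀ x, |g x| ≤ M) →
      ∫ x, g x ∂ν - ∫ x, g x ∂μ ≤ r) :
    Integrable (fun x : EuclideanSpace ℝ (Fin n) => x) ν := by
  refine ⟨measurable_id.aestronglyMeasurable, ?_⟩
  have hL : ∀ N : ℕ, LipschitzWith 1 fun x : EuclideanSpace ℝ (Fin n) => min ‖x‖ (N : ℝ) :=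
    fun N => lipschitzWith_one_norm.min_const _
  have hB : ∀ (N : ℕ) (x : EuclideanSpace ℝ (Fin n)), |min ‖x‖ (N : ℝ)| ≤ N := fun N x => by
    rw [abs_of_nonneg (by positivity)]
    exact min_le_right _ _
  have hI : ∀ (N : ℕ) (ρ : Measure (EuclideanSpace ℝ (Fin n))) [IsProbabilityMeasure ρ],
      Integrable (fun x => min ‖x‖ (N : ℝ)) ρ := fun N ρ _ =>
    .of_bound (hL N).continuous.aestronglyMeasurable N (.of_forall (hB N))
  have hbound : ∀ N : ℕ, ∫⁻ x, ENNReal.ofReal (min ‖x‖ (N : ℝ)) ∂ν ≤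
      ENNReal.ofReal (r + ∫ x, ‖x‖ ∂μ) := by
    intro N
    rw [← ofReal_integral_eq_lintegral_ofReal (hI N ν) (.of_forall fun x => by positivity)]
    refine ENNReal.ofReal_le_ofReal ?_
    have h1 := H _ (hL N) ⟨N, hB N⟩
    have h2 : ∫ x, min ‖x‖ (N : ℝ) ∂μ ≤ ∫ x, ‖x‖ ∂μ :=
      integral_mono (hI N μ) hμ.norm fun x => min_le_left _ _
    linarith
  have hlim : Filter.Tendsto (fun N : ℕ => ∫⁻ x, ENNReal.ofReal (min ‖x‖ (N : ℝ)) ∂ν) Filter.atTop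
      (nhds (∫⁻ x, ENNReal.ofReal ‖x‖ ∂ν)) := by
    refine lintegral_tendsto_of_tendsto_of_monotone
      (fun N => (hL N).continuous.measurable.ennreal_ofReal.aemeasurable)
      (.of_forall fun x a b hab => ?_) (.of_forall fun x => ?_)
    · exact ENNReal.ofReal_le_ofReal (min_le_min le_rfl (by exact_mod_cast hab))
    · refine tendsto_const_nhds.congr' ?_
      obtain ⟨N, hN⟩ := exists_nat_ge ‖x‖
      filter_upwards [Filter.eventually_ge_atTop N] with k hk
      rw [min_eq_left (hN.trans (by exact_mod_cast hk))]
  have := le_of_tendsto' hlim hbound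
  simp only [ofReal_norm] at this
  exact this.trans_lt ENNReal.ofReal_lt_top

/-- The hard half of Kantorovich–Rubinstein duality. -/
theorem wassersteinDist_one_le_of_forall_lipschitz {n : ℕ}
    {ν μ : Measure (EuclideanSpace ℝ (Fin n))}
    [IsProbabilityMeasure ν] [IsProbabilityMeasure μ]
    (hμ : Integrable (fun x : EuclideanSpace ℝ (Fin n) => x) μ) {r : ℝ}
    (H : ∀ g : EuclideanSpace ℝ (Fin n) → ℝ, LipschitzWith 1 g → (∃ M, ∀ x, |g x| ≤ M) →
      ∫ x, g x ∂ν - ∫ x, g x ∂μ ≤ r) :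
    wassersteinDist 1 ν μ ≤ ENNReal.ofReal r := by
  have hν := integrable_id_of_forall_lipschitz hμ H
  have hr : 0 ≤ r := by simpa using H (fun _ => 0) (LipschitzWith.const' 0) ⟨0, by simp⟩
  suffices hsuff : ∀ ε : ℝ, 0 < ε → wassersteinDist 1 ν μ ≤ ENNReal.ofReal (r + 2 * ε) by
    have hlim : Filter.Tendsto (fun ε : ℝ => ENNReal.ofReal (r + 2 * ε)) (nhdsWithin 0 (Set.Ioi 0))
        (nhds (ENNReal.ofReal r)) := by
      have : Continuous fun ε : ℝ => ENNReal.ofReal (r + 2 * ε) :=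
        ENNReal.continuous_ofReal.comp (by fun_prop)
      simpa using (this.tendsto 0).mono_left nhdsWithin_le_nhds
    exact ge_of_tendsto hlim (eventually_mem_nhdsWithin.mono fun ε hε => hsuff ε hε)
  intro ε hε
  have happrox := SimpleFunc.tendsto_approxOn_range_L1_enorm measurable_id (hν.add_measure hμ)
  obtain ⟨N, hN⟩ := (happrox.eventually_lt_const (ENNReal.ofReal_pos.2 hε)).exists
  set S := SimpleFunc.approxOn (fun x : EuclideanSpace ℝ (Fin n) => x) measurable_id
    (Set.range (fun x : EuclideanSpace ℝ (Fin n) => x) ∪ {0}) 0 (by simp) N with hS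
  replace hN : ∫⁻ x, edist x (S x) ∂ν + ∫⁻ x, edist x (S x) ∂μ ≤ ENNReal.ofReal ε := by
    rw [← lintegral_add_measure]
    refine le_trans (le_of_eq (lintegral_congr fun x => ?_)) hN.le
    rw [edist_comm, edist_eq_enorm_sub]
    rfl
  have hSd : Measurable fun x => dist x (S x) := measurable_id.dist S.measurable
  have hSi : Integrable (fun x => dist x (S x)) (ν + μ) := by
    refine ⟨hSd.aestronglyMeasurable, ?_⟩
    rw [HasFiniteIntegral, lintegral_add_measure]
    simp only [Real.enorm_of_nonneg dist_nonneg, ← edist_dist]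
    exact hN.trans_lt ENNReal.ofReal_lt_top
  obtain ⟨hSν, hSμ⟩ := integrable_add_measure.1 hSi
  have hSε : ∫ x, dist x (S x) ∂ν + ∫ x, dist x (S x) ∂μ ≤ ε := by
    rw [← ENNReal.ofReal_le_ofReal_iff hε.le, ENNReal.ofReal_add (by positivity) (by positivity),
      ofReal_integral_eq_lintegral_ofReal hSν (.of_forall fun _ => dist_nonneg),
      ofReal_integral_eq_lintegral_ofReal hSμ (.of_forall fun _ => dist_nonneg)]
    simpa only [← edist_dist] using hN
  set T : EuclideanSpace ℝ (Fin n) → S.range := fun x => ⟨S x, S.mem_range_self x⟩ with hT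
  have hTm : Measurable T := S.measurable.subtype_mk
  have hne : Nonempty S.range := ⟨T 0⟩
  have hpush : ∀ (ρ : Measure (EuclideanSpace ℝ (Fin n))) [IsProbabilityMeasure ρ]
      (h : S.range → ℝ), ∫ x, h (T x) ∂ρ = ∑ i, h i * ρ.real (T ⁻¹' {i}) := by
    intro ρ _ h
    rw [← integral_map hTm.aemeasurable (measurable_of_finite h).aestronglyMeasurable,
      integral_fintype (.of_finite)]
    refine Finset.sum_congr rfl fun i _ => ?_
    rw [map_measureReal_apply hTm (measurableSet_singleton i), smul_eq_mul, mul_comm]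
  have hsimplex : ∀ (ρ : Measure (EuclideanSpace ℝ (Fin n))) [IsProbabilityMeasure ρ],
      (fun i => ρ.real (T ⁻¹' {i})) ∈ stdSimplex ℝ S.range := fun ρ _ =>
    ⟨fun i => measureReal_nonneg, by simpa using (hpush ρ fun _ => 1).symm⟩
  obtain ⟨w, hw0, hw₁, hw₂, hwc⟩ := exists_transport_plan_of_dual_le
    (fun i j : S.range => dist (i : EuclideanSpace ℝ (Fin n)) j) (hsimplex ν) (hsimplex μ)
    (r := r + ε) fun φ ψ hφψ => by
      obtain ⟨g, hg, ⟨M, hM⟩, hgφ, hgψ⟩ := exists_lipschitzWith_one_of_add_le_dist hφψ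
      have hgi : ∀ (ρ : Measure (EuclideanSpace ℝ (Fin n))) [IsProbabilityMeasure ρ],
          Integrable g ρ := fun ρ _ =>
        .of_bound hg.continuous.aestronglyMeasurable M (.of_forall hM)
      have hfi : ∀ (ρ : Measure (EuclideanSpace ℝ (Fin n))) [IsProbabilityMeasure ρ]
          (h : S.range → ℝ), Integrable (fun x => h (T x)) ρ := fun ρ _ h =>
        (Integrable.of_finite (μ := ρ.map T) (f := h)).comp_measurable hTm
      have h1 : ∫ x, φ (T x) ∂ν ≤ ∫ x, g x ∂ν + ∫ x, dist x (S x) ∂ν := by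
        rw [← integral_add (hgi ν) hSν]
        refine integral_mono (hfi ν φ) ((hgi ν).add hSν) fun x => (hgφ (T x)).trans ?_
        have := hg.le_add_mul (S x) x
        rwa [NNReal.coe_one, one_mul, dist_comm] at this
      have h2 : ∫ x, ψ (T x) ∂μ ≤ -∫ x, g x ∂μ + ∫ x, dist x (S x) ∂μ := by
        have hneg : Integrable (fun x => -g x) μ := (hgi μ).neg
        rw [← integral_neg, ← integral_add hneg hSμ]
        refine integral_mono (hfi μ ψ) (hneg.add hSμ) fun x => ?_
        have h3 := hg.le_add_mul x (S x)
        have h4 : g (S x) ≤ -ψ (T x) := hgψ (T x)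
        simp only [NNReal.coe_one, one_mul] at h3
        linarith
      rw [← hpush ν φ, ← hpush μ ψ]
      linarith [H g hg ⟨M, hM⟩]
  refine (wassersteinDist_one_le_of_transport_plan hTm (fun i => (i : EuclideanSpace ℝ (Fin n)))
    (w := fun q => ENNReal.ofReal (w q)) (fun i => ?_) (fun j => ?_)).trans ?_
  · rw [← ENNReal.ofReal_sum_of_nonneg fun j _ => hw0 _, hw₁, ofReal_measureReal]
  · rw [← ENNReal.ofReal_sum_of_nonneg fun j _ => hw0 _, hw₂, ofReal_measureReal]
  · have hcost : ∑ q : S.range × S.range, ENNReal.ofReal (w q) *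
        edist (q.1 : EuclideanSpace ℝ (Fin n)) q.2 ≤ ENNReal.ofReal (r + ε) := by
      simp only [edist_dist, ← ENNReal.ofReal_mul (hw0 _)]
      rw [← ENNReal.ofReal_sum_of_nonneg fun q _ => mul_nonneg (hw0 _) dist_nonneg]
      exact ENNReal.ofReal_le_ofReal hwc
    calc _ = (∫⁻ x, edist x (S x) ∂ν + ∫⁻ x, edist x (S x) ∂μ) +
          ∑ q : S.range × S.range, ENNReal.ofReal (w q) *
            edist (q.1 : EuclideanSpace ℝ (Fin n)) q.2 := add_right_comm _ _ _
      _ ≤ ENNReal.ofReal ε + ENNReal.ofReal (r + ε) := add_le_add hN hcost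
      _ = ENNReal.ofReal (r + 2 * ε) := by
          rw [← ENNReal.ofReal_add hε.le (by positivity)]
          ring_nf

/-- If `α(W₁(ν,μ)) ≤ I(ν|μ)` for all `ν`, with `α` convex and not identically zero, then `μ` has
finite first moment. -/
theorem integrable_id_of_le_fisherInfo {n : ℕ} {μ : Measure (EuclideanSpace ℝ (Fin n))}
    [IsProbabilityMeasure μ] {α : ℝ → ℝ} (hα0 : α 0 = 0) (hαconv : ConvexOn ℝ (Set.Ici 0) α)
    (hαWI : ∀ ν : Measure (EuclideanSpace ℝ (Fin n)), IsProbabilityMeasure ν →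
      ∀ r : ℝ, 0 ≤ r → ENNReal.ofReal r ≤ wassersteinDist 1 ν μ →
        ENNReal.ofReal (α r) ≤ fisherInfo ν μ)
    {r : ℝ} (hr : 0 ≤ r) (hαr : 0 < α r) :
    Integrable (fun x : EuclideanSpace ℝ (Fin n) => x) μ := by
  set φ : EuclideanSpace ℝ (Fin n) → ℝ := fun x => -Real.log (1 + ‖x‖ ^ 2) with hφdef
  have hpos : ∀ x : EuclideanSpace ℝ (Fin n), 0 < 1 + ‖x‖ ^ 2 := fun x => by positivity
  have hder : ∀ x, HasFDerivAt φ (-((1 + ‖x‖ ^ 2)⁻¹ • (2 • innerSL ℝ x))) x := fun x =>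
    (((hasStrictFDerivAt_norm_sq x).hasFDerivAt.const_add 1).log (hpos x).ne').neg
  have hφ : Differentiable ℝ φ := fun x => (hder x).differentiableAt
  have hK : ∀ x, ‖fderiv ℝ φ x‖ ≤ 1 := by
    intro x
    rw [(hder x).fderiv, norm_neg, norm_smul, norm_inv, Real.norm_of_nonneg (hpos x).le,
      ← Nat.cast_smul_eq_nsmul ℝ, norm_smul, innerSL_apply_norm, inv_mul_le_iff₀ (hpos x)]
    norm_num
    nlinarith [sq_nonneg (‖x‖ - 1)]
  have hexp : ∀ x, Real.exp (φ x) = (1 + ‖x‖ ^ 2)⁻¹ := fun x => by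
    rw [hφdef, Real.exp_neg, Real.exp_log (hpos x)]
  have hφc : Continuous fun x => Real.exp (φ x) := Real.continuous_exp.comp hφ.continuous
  have hint : Integrable (fun x => Real.exp (φ x)) μ := by
    refine .of_bound hφc.aestronglyMeasurable 1 (.of_forall fun x => ?_)
    rw [hexp, norm_inv, Real.norm_of_nonneg (hpos x).le]
    exact inv_le_one_of_one_le₀ (by nlinarith [sq_nonneg ‖x‖])
  have hprob := isProbabilityMeasure_tilted hint
  have hνi : Integrable (fun x : EuclideanSpace ℝ (Fin n) => x) (μ.tilted φ) := by
    rw [integrable_tilted_iff hint]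
    refine .of_bound (hφc.smul continuous_id).aestronglyMeasurable 1 (.of_forall fun x => ?_)
    rw [norm_smul, hexp, norm_inv, Real.norm_of_nonneg (hpos x).le, inv_mul_le_iff₀ (hpos x)]
    nlinarith [sq_nonneg (‖x‖ - 1)]
  by_contra hn
  have hW : wassersteinDist 1 (μ.tilted φ) μ = ⊤ := by
    rw [wassersteinDist_one]
    refine iInf₂_eq_top.2 fun π hπ => ?_
    by_contra hfin
    refine hn ⟨measurable_id.aestronglyMeasurable, ?_⟩
    have h1 : ∫⁻ q, ‖q.1‖ₑ ∂π < ⊤ := by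
      have h := hνi.2
      rw [HasFiniteIntegral, ← hπ.1, lintegral_map measurable_enorm measurable_fst] at h
      exact h
    rw [HasFiniteIntegral, ← hπ.2, lintegral_map measurable_enorm measurable_snd]
    calc ∫⁻ q, ‖q.2‖ₑ ∂π ≤ ∫⁻ q, (‖q.1‖ₑ + edist q.1 q.2) ∂π := by
          refine lintegral_mono fun q => ?_
          simpa [edist_comm q.1 q.2, add_comm] using edist_triangle q.2 q.1 0
      _ = ∫⁻ q, ‖q.1‖ₑ ∂π + ∫⁻ q, edist q.1 q.2 ∂π :=
          lintegral_add_left (measurable_fst.enorm) _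
      _ < ⊤ := ENNReal.add_lt_top.2 ⟨h1, lt_top_iff_ne_top.2 hfin⟩
  set t : ℝ := 1 + 1 / α r with ht
  have ht1 : 1 ≤ t := by
    rw [ht]
    linarith [one_div_pos.2 hαr]
  have hgrow : t * α r ≤ α (t * r) := by
    have hcv := hαconv.2 (show t * r ∈ Set.Ici (0 : ℝ) from Set.mem_Ici.2 (by positivity))
      Set.self_mem_Ici (by positivity : 0 ≤ t⁻¹) (sub_nonneg.2 (inv_le_one_of_one_le₀ ht1))
      (add_sub_cancel _ _)
    rw [smul_eq_mul, smul_eq_mul, smul_eq_mul, smul_eq_mul, hα0, mul_zero, add_zero,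
      add_zero, inv_mul_cancel_left₀ (by positivity), le_inv_mul_iff₀ (by positivity)] at hcv
    exact hcv
  have hle := (hαWI _ hprob (t * r) (by positivity) (by simp [hW])).trans
    (fisherInfo_tilted_le hφ hK hint)
  rw [ENNReal.ofReal_le_ofReal_iff (by norm_num)] at hle
  have : t * α r = α r + 1 := by
    rw [ht]
    field_simp
  linarith

theorem integral_two_mul_sqrt_le_integral_llr_of_differentiable {n : ℕ}
    {ν μ : Measure (EuclideanSpace ℝ (Fin n))} [IsProbabilityMeasure ν] [IsProbabilityMeasure μ]
    {α : ℝ → ℝ} (hα0 : α 0 = 0) (hαmono : MonotoneOn α (Set.Ici 0))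
    (hαWI : ∀ ν : Measure (EuclideanSpace ℝ (Fin n)), IsProbabilityMeasure ν →
      ∀ r : ℝ, 0 ≤ r → ENNReal.ofReal r ≤ wassersteinDist 1 ν μ →
        ENNReal.ofReal (α r) ≤ fisherInfo ν μ)
    (hνμ : ν ≪ μ) (hllr : Integrable (llr ν μ) ν) {g : EuclideanSpace ℝ (Fin n) → ℝ}
    (hgd : Differentiable ℝ g) (hg : LipschitzWith 1 g) {M : ℝ} (hM : ∀ x, |g x| ≤ M)
    {r : ℝ} (hr : 0 ≤ r) (h : r ≤ ∫ x, g x ∂ν - ∫ x, g x ∂μ) :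
    2 * ∫ s in (0:ℝ)..r, Real.sqrt (α s) ≤ ∫ x, llr ν μ x ∂ν := by
  have hgi : ∀ (ρ : Measure (EuclideanSpace ℝ (Fin n))) [IsProbabilityMeasure ρ],
      Integrable g ρ := fun ρ _ =>
    .of_bound hg.continuous.aestronglyMeasurable M (.of_forall hM)
  have hexp : ∀ t : ℝ, Integrable (fun x => Real.exp (t * g x)) μ := fun t =>
    ProbabilityTheory.integrable_exp_mul_of_mem_Icc hg.continuous.aemeasurable
      (.of_forall fun x => abs_le.1 (hM x))
  have hset : ∀ t : ℝ, t ∈ interior (ProbabilityTheory.integrableExpSet g μ) := by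
    simp [ProbabilityTheory.integrableExpSet, hexp]
  set F : ℝ → ℝ := fun t => ProbabilityTheory.cgf g μ t - t * ∫ x, g x ∂μ with hF
  have hFder : ∀ t, HasDerivAt F (∫ x, g x ∂(μ.tilted fun x => t * g x) - ∫ x, g x ∂μ) t := by
    intro t
    have h1 := (ProbabilityTheory.analyticAt_cgf (hset t)).differentiableAt.hasDerivAt
    rw [← ProbabilityTheory.integral_tilted_mul_self (hset t)] at h1
    exact h1.sub (by simpa using (hasDerivAt_id t).mul_const (∫ x, g x ∂μ))
  have hu : MonotoneOn (fun s => 2 * Real.sqrt (α s)) (Set.Ici 0) := fun a ha b hb hab =>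
    mul_le_mul_of_nonneg_left (Real.sqrt_le_sqrt (hαmono ha hb hab)) zero_le_two
  have key := add_integral_le_mul_of_deriv_le_inverse (F := F)
    (u := fun s => 2 * Real.sqrt (α s)) (fun t => (hFder t).differentiableAt)
    (by simp [hF]) (by simp [hα0]) hu (fun t ht s hs hst => ?_) hr
  · have hDV := integral_sub_log_integral_exp_le_integral_llr hνμ hllr
      ((hgi ν).const_mul (2 * Real.sqrt (α r))) (hexp _)
    rw [integral_const_mul] at hDV
    rw [intervalIntegral.integral_const_mul] at key
    simp only [hF, ProbabilityTheory.cgf, ProbabilityTheory.mgf] at key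
    have := mul_le_mul_of_nonneg_left h (by positivity : 0 ≤ 2 * Real.sqrt (α r))
    linarith
  · rw [(hFder t).deriv] at hst
    have hprob := isProbabilityMeasure_tilted (hexp t)
    have hW := (ENNReal.ofReal_le_ofReal hst).trans
      (ofReal_integral_sub_le_wassersteinDist hg (hgi (μ.tilted fun x => t * g x)) (hgi μ))
    have hK : ∀ x, ‖fderiv ℝ (fun x => t * g x) x‖ ≤ t := by
      intro x
      rw [fderiv_const_mul (hgd x), norm_smul, Real.norm_of_nonneg ht]
      exact mul_le_of_le_one_right ht (by simpa using norm_fderiv_le_of_lipschitz ℝ hg (x₀ := x))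
    have hle := (hαWI _ hprob s hs hW).trans (fisherInfo_tilted_le (hgd.const_mul t) hK (hexp t))
    rw [ENNReal.ofReal_le_ofReal_iff (by positivity)] at hle
    have : Real.sqrt (α s) ≤ t / 2 := Real.sqrt_le_iff.2 ⟨by positivity, by linarith [div_pow t 2 2]⟩
    linarith

/-- The entropy of `ν` is bounded below in terms of the mean discrepancy of a bounded `1`-Lipschitz
function. -/
theorem integral_two_mul_sqrt_le_integral_llr {n : ℕ}
    {ν μ : Measure (EuclideanSpace ℝ (Fin n))} [IsProbabilityMeasure ν] [IsProbabilityMeasure μ]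
    {α : ℝ → ℝ} (hα0 : α 0 = 0) (hαmono : MonotoneOn α (Set.Ici 0))
    (hαWI : ∀ ν : Measure (EuclideanSpace ℝ (Fin n)), IsProbabilityMeasure ν →
      ∀ r : ℝ, 0 ≤ r → ENNReal.ofReal r ≤ wassersteinDist 1 ν μ →
        ENNReal.ofReal (α r) ≤ fisherInfo ν μ)
    (hνμ : ν ≪ μ) (hllr : Integrable (llr ν μ) ν) {g : EuclideanSpace ℝ (Fin n) → ℝ}
    (hg : LipschitzWith 1 g) {M : ℝ} (hM : ∀ x, |g x| ≤ M)
    {r : ℝ} (hr : 0 ≤ r) (h : r < ∫ x, g x ∂ν - ∫ x, g x ∂μ) :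
    2 * ∫ s in (0:ℝ)..r, Real.sqrt (α s) ≤ ∫ x, llr ν μ x ∂ν := by
  set ε : ℝ := (∫ x, g x ∂ν - ∫ x, g x ∂μ - r) / 2 with hε
  have hε0 : 0 < ε := by linarith
  obtain ⟨f, hfd, hf, hfg⟩ := hg.exists_differentiable_dist_le hε0
  have hfM : ∀ x, |f x| ≤ M + ε := fun x => by
    have := abs_add_le (g x) (f x - g x)
    rw [add_sub_cancel] at this
    linarith [hM x, hfg x]
  have hgi : ∀ (ρ : Measure (EuclideanSpace ℝ (Fin n))) [IsProbabilityMeasure ρ],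
      Integrable g ρ := fun ρ _ =>
    .of_bound hg.continuous.aestronglyMeasurable M (.of_forall hM)
  have hfi : ∀ (ρ : Measure (EuclideanSpace ℝ (Fin n))) [IsProbabilityMeasure ρ],
      Integrable f ρ := fun ρ _ =>
    .of_bound hf.continuous.aestronglyMeasurable (M + ε) (.of_forall hfM)
  have hd : ∀ (ρ : Measure (EuclideanSpace ℝ (Fin n))) [IsProbabilityMeasure ρ],
      |∫ x, f x ∂ρ - ∫ x, g x ∂ρ| ≤ ε := fun ρ _ => by
    rw [← integral_sub (hfi ρ) (hgi ρ), ← Real.norm_eq_abs]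
    simpa using norm_integral_le_of_norm_le_const (μ := ρ) (f := fun x => f x - g x) (.of_forall hfg)
  refine integral_two_mul_sqrt_le_integral_llr_of_differentiable hα0 hαmono hαWI hνμ hllr hfd hf
    hfM hr ?_
  linarith [abs_le.1 (hd ν), abs_le.1 (hd μ)]

theorem MonotoneOn.integral_sqrt_eq_zero {α : ℝ → ℝ} (hα : MonotoneOn α (Set.Ici 0)) {r : ℝ}
    (hr : 0 ≤ r) (hαr : α r = 0) : ∫ s in (0:ℝ)..r, Real.sqrt (α s) = 0 := by
  rw [intervalIntegral.integral_congr (g := fun _ => (0 : ℝ)) fun s hs => ?_]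
  · simp
  · rw [Set.uIcc_of_le hr] at hs
    exact Real.sqrt_eq_zero_of_nonpos (hαr ▸ hα hs.1 hr hs.2)

/-- The entropy of `ν` is bounded below by the primitive of `2√α` at the transport cost. -/
theorem ofReal_integral_two_mul_sqrt_le_relEntropy {n : ℕ}
    {ν μ : Measure (EuclideanSpace ℝ (Fin n))} [IsProbabilityMeasure ν] [IsProbabilityMeasure μ]
    {α : ℝ → ℝ} (hα0 : α 0 = 0) (hαnonneg : ∀ r, 0 ≤ r → 0 ≤ α r)
    (hαmono : MonotoneOn α (Set.Ici 0)) (hαconv : ConvexOn ℝ (Set.Ici 0) α)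
    (hαWI : ∀ ν : Measure (EuclideanSpace ℝ (Fin n)), IsProbabilityMeasure ν →
      ∀ r : ℝ, 0 ≤ r → ENNReal.ofReal r ≤ wassersteinDist 1 ν μ →
        ENNReal.ofReal (α r) ≤ fisherInfo ν μ)
    {r : ℝ} (hr : 0 ≤ r) (hW : ENNReal.ofReal r ≤ wassersteinDist 1 ν μ) :
    ENNReal.ofReal (2 * ∫ s in (0:ℝ)..r, Real.sqrt (α s)) ≤ relEntropy ν μ := by
  rw [relEntropy]
  split_ifs with hH
  swap
  · exact le_top
  obtain ⟨hνμ, hllr⟩ := hH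
  refine ENNReal.ofReal_le_ofReal ?_
  have hsqrt : MonotoneOn (fun s => Real.sqrt (α s)) (Set.Ici 0) := fun a ha b hb hab =>
    Real.sqrt_le_sqrt (hαmono ha hb hab)
  have hii : ∀ a b, 0 ≤ a → 0 ≤ b →
      IntervalIntegrable (fun s => Real.sqrt (α s)) volume a b := fun a b ha hb =>
    (hsqrt.mono fun x hx => (le_min ha hb).trans hx.1).intervalIntegrable
  have hlt : ∀ r', 0 ≤ r' → r' < r → 0 < α r →
      2 * ∫ s in (0:ℝ)..r', Real.sqrt (α s) ≤ ∫ x, llr ν μ x ∂ν := by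
    intro r' hr' hrr hαr
    have hμi := integrable_id_of_le_fisherInfo hα0 hαconv hαWI hr hαr
    by_contra hcon
    refine absurd (hW.trans (wassersteinDist_one_le_of_forall_lipschitz hμi (r := r') ?_)) ?_
    · rintro g hg ⟨M, hM⟩
      by_contra hgr
      exact hcon (integral_two_mul_sqrt_le_integral_llr hα0 hαmono hαWI hνμ hllr hg hM hr'
        (not_le.1 hgr))
    · rw [not_le]
      exact (ENNReal.ofReal_lt_ofReal_iff (hr'.trans_lt hrr)).2 hrr
  obtain hαr | hαr := (hαnonneg r hr).eq_or_lt
  · have hDV := integral_sub_log_integral_exp_le_integral_llr hνμ hllr (f := fun _ => 0)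
      (integrable_const _) (by simp)
    simpa [hαmono.integral_sqrt_eq_zero hr hαr.symm] using hDV
  · have hr0 : 0 < r := hr.lt_of_ne fun h => by
      rw [← h, hα0] at hαr
      exact hαr.false
    have hcont : ContinuousWithinAt (fun b => 2 * ∫ s in (0:ℝ)..b, Real.sqrt (α s))
        (Set.Iio r) r := by
      have h1 := (intervalIntegral.continuousOn_primitive_interval' (hii 0 r le_rfl hr)
        Set.left_mem_uIcc) r Set.right_mem_uIcc
      rw [Set.uIcc_of_le hr] at h1
      exact (h1.mono_of_mem_nhdsWithin (Icc_mem_nhdsLT hr0)).const_mul 2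
    refine le_of_tendsto hcont ?_
    filter_upwards [Ioo_mem_nhdsLT hr0] with b hb using hlt b hb.1.le hb.2 hαr

theorem relEntropy_cond {n : ℕ} {μ : Measure (EuclideanSpace ℝ (Fin n))} [IsProbabilityMeasure μ]
    {A : Set (EuclideanSpace ℝ (Fin n))} (hA : MeasurableSet A) (hμA : μ A ≠ 0) :
    relEntropy (ProbabilityTheory.cond μ A) μ = ENNReal.ofReal (-Real.log (μ.real A)) := by
  have hprob := ProbabilityTheory.cond_isProbabilityMeasure hμA
  have hac : ProbabilityTheory.cond μ A ≪ μ := ProbabilityTheory.cond_absolutelyContinuous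
  have hllr : llr (ProbabilityTheory.cond μ A) μ =ᵐ[ProbabilityTheory.cond μ A]
      fun _ => -Real.log (μ.real A) := by
    have h1 := Measure.rnDeriv_smul_left_of_ne_top' (μ.restrict A) μ (ENNReal.inv_ne_top.2 hμA)
    have h2 := Measure.rnDeriv_restrict_self μ hA
    filter_upwards [hac h1, hac h2, ProbabilityTheory.ae_cond_mem hA] with x hx1 hx2 hx3
    have hx : (ProbabilityTheory.cond μ A).rnDeriv μ x = (μ A)⁻¹ := by
      rw [ProbabilityTheory.cond, hx1, Pi.smul_apply, hx2]
      simp [hx3]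
    rw [llr, hx, ENNReal.toReal_inv, Real.log_inv, measureReal_def]
  rw [relEntropy, if_pos ⟨hac, (integrable_const _).congr hllr.symm⟩, integral_congr_ae hllr]
  simp

/-- Deviation inequality from a lower bound on the entropy in terms of the transport cost. -/
theorem measure_add_lt_le_ofReal_exp_neg {n : ℕ} {μ : Measure (EuclideanSpace ℝ (Fin n))}
    [IsProbabilityMeasure μ] (hμ : Integrable (fun x : EuclideanSpace ℝ (Fin n) => x) μ)
    {r c : ℝ} (H : ∀ ν : Measure (EuclideanSpace ℝ (Fin n)), IsProbabilityMeasure ν →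
      ENNReal.ofReal r ≤ wassersteinDist 1 ν μ → ENNReal.ofReal c ≤ relEntropy ν μ)
    {g : EuclideanSpace ℝ (Fin n) → ℝ} (hg : LipschitzWith 1 g) :
    μ {x | (∫ y, g y ∂μ) + r < g x} ≤ ENNReal.ofReal (Real.exp (-c)) := by
  set A := {x | (∫ y, g y ∂μ) + r < g x} with hAdef
  have hA : MeasurableSet A := measurableSet_lt measurable_const hg.continuous.measurable
  obtain hμA | hμA := eq_or_ne (μ A) 0
  · simp [hμA]
  have hprob := ProbabilityTheory.cond_isProbabilityMeasure hμA
  have hgμ : Integrable g μ := by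
    refine (hμ.norm.add (integrable_const |g 0|)).mono' hg.continuous.aestronglyMeasurable
      (.of_forall fun x => ?_)
    have h1 := hg.dist_le_mul x 0
    rw [NNReal.coe_one, one_mul, dist_zero_right, Real.dist_eq] at h1
    have h2 := abs_add_le (g x - g 0) (g 0)
    rw [sub_add_cancel] at h2
    rw [Real.norm_eq_abs, Pi.add_apply]
    linarith
  have hgν : Integrable g (ProbabilityTheory.cond μ A) :=
    hgμ.restrict.smul_measure (ENNReal.inv_ne_top.2 hμA)
  have hge : (∫ y, g y ∂μ) + r ≤ ∫ y, g y ∂(ProbabilityTheory.cond μ A) := by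
    have := integral_mono_ae (μ := ProbabilityTheory.cond μ A) (integrable_const _) hgν
      ((ProbabilityTheory.ae_cond_mem hA).mono fun x hx => le_of_lt hx)
    simpa using this
  have hent := H _ hprob ((ENNReal.ofReal_le_ofReal (by linarith)).trans
    (ofReal_integral_sub_le_wassersteinDist hg hgν hgμ))
  have hpos : 0 < μ.real A := ENNReal.toReal_pos hμA (measure_ne_top _ _)
  rw [relEntropy_cond hA hμA, ENNReal.ofReal_le_ofReal_iff
    (neg_nonneg.2 (Real.log_nonpos hpos.le measureReal_le_one))] at hent
  rw [← ofReal_measureReal]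
  refine ENNReal.ofReal_le_ofReal ?_
  rw [← Real.log_le_iff_le_exp hpos]
  linarith

/-- **α-W₁I implies α̃-W₁H** (Proposition 2.3): if `α(W₁(ν,μ)) ≤ I(ν|μ)` for all `ν`
(encoded, via left-continuity and monotonicity of `α`, as `α(r) ≤ I(ν|μ)` whenever
`r ≤ W₁(ν,μ)`), then `α̃(W₁(ν,μ)) ≤ H(ν|μ)` where `α̃(r) = 2∫₀^r √α(s) ds`; in
particular `μ(g > μ(g) + r) ≤ e^{−α̃(r)}` for all 1-Lipschitz `g` and `r > 0`. -/
theorem alphaW1I_implies_alphaW1H {n : ℕ}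
    (V : EuclideanSpace ℝ (Fin n) → ℝ) (hV : ContDiff ℝ 1 V) (Z : ℝ) (hZ : 0 < Z)
    (μ : Measure (EuclideanSpace ℝ (Fin n)))
    (hμ : μ = volume.withDensity fun x => ENNReal.ofReal (Real.exp (-V x) / Z))
    (hμprob : IsProbabilityMeasure μ)
    (α : ℝ → ℝ) (hα0 : α 0 = 0) (hαnonneg : ∀ r, 0 ≤ r → 0 ≤ α r)
    (hαmono : MonotoneOn α (Set.Ici 0)) (hαconv : ConvexOn ℝ (Set.Ici 0) α)
    (hαlc : ∀ r : ℝ, 0 < r → ContinuousWithinAt α (Set.Iio r) r)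
    (hαWI : ∀ ν : Measure (EuclideanSpace ℝ (Fin n)), IsProbabilityMeasure ν →
      ∀ r : ℝ, 0 ≤ r → ENNReal.ofReal r ≤ wassersteinDist 1 ν μ →
        ENNReal.ofReal (α r) ≤ fisherInfo ν μ) :
    (∀ ν : Measure (EuclideanSpace ℝ (Fin n)), IsProbabilityMeasure ν →
      ∀ r : ℝ, 0 ≤ r → ENNReal.ofReal r ≤ wassersteinDist 1 ν μ →
        ENNReal.ofReal (2 * ∫ s in (0:ℝ)..r, Real.sqrt (α s)) ≤ relEntropy ν μ) ∧
    (∀ g : EuclideanSpace ℝ (Fin n) → ℝ, LipschitzWith 1 g → ∀ r : ℝ, 0 < r →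
      μ {x | (∫ y, g y ∂μ) + r < g x} ≤
        ENNReal.ofReal (Real.exp (-(2 * ∫ s in (0:ℝ)..r, Real.sqrt (α s))))) := by
  have hent := fun (ν : Measure (EuclideanSpace ℝ (Fin n))) (_ : IsProbabilityMeasure ν) (r : ℝ)
      (hr : 0 ≤ r) => ofReal_integral_two_mul_sqrt_le_relEntropy (ν := ν) hα0 hαnonneg hαmono
    hαconv hαWI hr
  refine ⟨hent, fun g hg r hr => ?_⟩
  obtain hαr | hαr := (hαnonneg r hr.le).eq_or_lt
  · simpa [hαmono.integral_sqrt_eq_zero hr.le hαr.symm] using prob_le_one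
  · exact measure_add_lt_le_ofReal_exp_neg
      (integrable_id_of_le_fisherInfo hα0 hαconv hαWI hr.le hαr)
      (fun ν hν hW => hent ν hν r hr.le hW) hg
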